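/- arXiv:2309.02018 — 2 statements merged into one kernel-verified Lean document; each statement's English description precedes it below -/
import Mathlib

section
/- (Transference lemma) Let n ∈ ℕ and T₀,…,Tₙ > 0. Let L₀,…,Lₙ be linear forms in the variables u₀,…,uₙ with real coefficient matrix M having determinant d ≠ 0, and let L′₀,…,L′ₙ be the transposed system of linear forms in v₀,…,vₙ, characterized by Σ_{i=0}^n Lᵢ(u)·L′ᵢ(v) = Σ_{i=0}^n uᵢvᵢ for all u, v ∈ ℝ^{n+1} (equivalently, the coefficient matrix of the L′ᵢ is (Mᵀ)⁻¹). Let ι := (T₀T₁⋯Tₙ/|d|)^{1/n}. If there exists (u₀,…,uₙ) ∈ ℤ^{n+1}\{0} with |Lᵢ(u₀,…,uₙ)| ≤ Tᵢ for all 0 ≤ i ≤ n, then there exists (v₀,…,vₙ) ∈ ℤ^{n+1}\{0} with |L′₀(v₀,…,vₙ)| ≤ n·ι/T₀ and |L′ᵢ(v₀,…,vₙ)| ≤ ι/Tᵢ for all 1 ≤ i ≤ n. -/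
/- STATEMENT 4: Mahler's transference lemma. -/

open Matrix

open MeasureTheory

/-- Integrating over a window of fixed length a function that decreases with the distance to the
origin gives a smaller value when the centre of the window is further from the origin. -/
lemma setLIntegral_Icc_le_of_abs_le {g : ℝ → ENNReal} (hg : ∀ x y, |x| ≤ |y| → g y ≤ g x)
    (c : ℝ) {p q : ℝ} (hpq : |p| ≤ |q|) :
    ∫⁻ y in Set.Icc (-c) c, g (y + q) ≤ ∫⁻ y in Set.Icc (-c) c, g (y + p) := by
  have translate (a : ℝ) : ∫⁻ y in Set.Icc (-c) c, g (y + a) =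
      ∫⁻ y in Set.Icc (a - c) (a + c), g y := by
    rw [← (measurePreserving_add_right volume a).setLIntegral_comp_preimage_emb
      (MeasurableEquiv.addRight a).measurableEmbedding g (Set.Icc (a - c) (a + c))]
    congr 2
    ext y
    simp only [Set.mem_preimage, Set.mem_Icc]
    constructor <;> rintro ⟨h₁, h₂⟩ <;> constructor <;> linarith
  rw [translate, translate, ← lintegral_inter_add_sdiff g (Set.Icc (q - c) (q + c))
    (measurableSet_Icc (a := p - c) (b := p + c)), ← lintegral_inter_add_sdiff g
    (Set.Icc (p - c) (p + c)) (measurableSet_Icc (a := q - c) (b := q + c)), Set.inter_comm]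
  refine add_le_add le_rfl ?_
  have reflect : (fun x => p + q - x) ⁻¹'
      (Set.Icc (q - c) (q + c) \ Set.Icc (p - c) (p + c)) =
      Set.Icc (p - c) (p + c) \ Set.Icc (q - c) (q + c) := by
    ext x
    simp only [Set.mem_preimage, Set.mem_sdiff, Set.mem_Icc]
    constructor <;> rintro ⟨⟨h₁, h₂⟩, h⟩ <;> refine ⟨⟨by linarith, by linarith⟩, ?_⟩ <;>
      rintro ⟨h₃, h₄⟩ <;> exact h ⟨by linarith, by linarith⟩
  rw [← (Measure.measurePreserving_sub_left volume (p + q)).setLIntegral_comp_preimage_emb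
      (MeasurableEquiv.subLeft (p + q)).measurableEmbedding, reflect]
  refine setLIntegral_mono' (measurableSet_Icc.diff measurableSet_Icc) fun x hx => hg _ _ ?_
  simp only [Set.mem_sdiff, Set.mem_Icc, not_and_or, not_le] at hx
  obtain ⟨⟨h₁, h₂⟩, h⟩ := hx
  rw [← sq_le_sq] at hpq ⊢
  rcases h with h | h
  · have : 0 < q - p := by linarith
    nlinarith [mul_nonneg (show 0 ≤ p + q by nlinarith) (show 0 ≤ p + q - 2 * x by linarith)]
  · have : 0 < p - q := by linarith
    nlinarith [mul_nonneg (show 0 ≤ -(p + q) by nlinarith) (show 0 ≤ 2 * x - (p + q) by linarith)]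

/-- The part of the box with half-sides `c i` on which the affine form `∑ i, t i * y i + s` is at
most `r` in absolute value. -/
def boxSlab {m : ℕ} (c t : Fin m → ℝ) (r s : ℝ) : Set (Fin m → ℝ) :=
  {y | (∀ i, |y i| ≤ c i) ∧ |∑ i, t i * y i + s| ≤ r}

lemma isClosed_boxSlab {m : ℕ} (c t : Fin m → ℝ) (r s : ℝ) : IsClosed (boxSlab c t r s) := by
  have box : IsClosed {y : Fin m → ℝ | ∀ i, |y i| ≤ c i} := by
    simp only [Set.ofPred_forall]
    exact isClosed_iInter fun i => isClosed_le (by fun_prop) (by fun_prop)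
  have slab : IsClosed {y : Fin m → ℝ | |∑ i, t i * y i + s| ≤ r} :=
    isClosed_le (by fun_prop) (by fun_prop)
  exact box.inter slab

/-- Volume of a set by slicing along the coordinate `0`. -/
lemma volume_eq_lintegral_cons {m : ℕ} {S : Set (Fin (m + 1) → ℝ)} (hS : MeasurableSet S) :
    volume S = ∫⁻ x : ℝ, volume {y : Fin m → ℝ | (Fin.cons x y : Fin (m + 1) → ℝ) ∈ S} := by
  have e := (volume_preserving_piFinSuccAbove (fun _ : Fin (m + 1) => ℝ) 0).symm
  rw [← e.measure_preimage_equiv S, Measure.volume_eq_prod,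
    Measure.prod_apply ((MeasurableEquiv.measurable _) hS)]
  refine lintegral_congr fun x => congrArg _ ?_
  ext y
  simp [MeasurableEquiv.piFinSuccAbove, Fin.insertNthEquiv]

lemma volume_boxSlab_le_of_abs_le {m : ℕ} (c t : Fin m → ℝ) (r : ℝ) {s s' : ℝ}
    (h : |s| ≤ |s'|) : volume (boxSlab c t r s') ≤ volume (boxSlab c t r s) := by
  induction m generalizing s s' with
  | zero =>
    refine measure_mono fun y hy => ⟨fun i => i.elim0, ?_⟩
    have := hy.2
    simp only [Finset.univ_eq_empty, Finset.sum_empty, zero_add] at this ⊢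
    exact h.trans this
  | succ m ih =>
    have slice (a : ℝ) : volume (boxSlab c t r a) = ∫⁻ x in Set.Icc (-c 0) (c 0),
        volume (boxSlab (Fin.tail c) (Fin.tail t) r (t 0 * x + a)) := by
      rw [volume_eq_lintegral_cons (isClosed_boxSlab c t r a).measurableSet,
        ← lintegral_indicator measurableSet_Icc]
      refine lintegral_congr fun x => ?_
      by_cases hx : x ∈ Set.Icc (-c 0) (c 0)
      · rw [Set.indicator_of_mem hx]
        congr 1
        ext y
        simp only [boxSlab, Set.mem_ofPred_eq, Fin.forall_fin_succ, Fin.sum_univ_succ, Fin.cons_zero,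
          Fin.cons_succ, Fin.tail, abs_le.2 hx, true_and]
        rw [add_comm (t 0 * x), add_assoc]
      · rw [Set.indicator_of_notMem hx]
        convert measure_empty (μ := volume) using 2
        ext y
        simp only [Set.mem_ofPred_eq, Set.mem_empty_iff_false, iff_false]
        exact fun hy => hx (abs_le.1 (by simpa using hy.1 0))
    rw [slice, slice]
    rcases eq_or_ne (t 0) 0 with ht | ht
    · simp only [ht, zero_mul, zero_add]
      exact lintegral_mono fun _ => ih _ _ h
    · have factor (a x : ℝ) : t 0 * x + a = t 0 * (x + a / t 0) := by field_simp
      simp only [factor]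
      refine setLIntegral_Icc_le_of_abs_le
        (g := fun x => volume (boxSlab (Fin.tail c) (Fin.tail t) r (t 0 * x)))
        (fun x y hxy => ih _ _ ?_) _ ?_
      · rw [abs_mul, abs_mul]
        gcongr
      · rw [abs_div, abs_div]
        gcongr

/-- A central slab cut out of a box by a linear form that varies by at most its width along each
side: stretching one side by the dimension compensates for the volume lost. -/
lemma prod_le_volume_stretched_boxSlab {m : ℕ} {c t : Fin (m + 1) → ℝ} {r : ℝ} (hr : 0 < r)
    (hc : ∀ i, 0 < c i) (htc : ∀ i, |t i| * c i ≤ r) :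
    ∏ i, ENNReal.ofReal (2 * c i) ≤
      volume (boxSlab (Function.update c 0 ((m + 1 : ℕ) * c 0)) t r 0) := by
  set ρ := r / c 0 with hρ
  have hc0 := hc 0
  have ρ_pos : 0 < ρ := div_pos hr hc0
  set W : Set (ℝ × (Fin m → ℝ)) := {p | p.2 ∈ boxSlab (Fin.tail c) (Fin.tail t) r (ρ * p.1)}
  have W_meas : MeasurableSet W := by
    have box : IsClosed {p : ℝ × (Fin m → ℝ) | ∀ i, |p.2 i| ≤ Fin.tail c i} := by
      simp only [Set.ofPred_forall]
      exact isClosed_iInter fun i => isClosed_le (by fun_prop) (by fun_prop)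
    have slab : IsClosed {p : ℝ × (Fin m → ℝ) | |∑ i, Fin.tail t i * p.2 i + ρ * p.1| ≤ r} :=
      isClosed_le (by fun_prop) (by fun_prop)
    exact (box.inter slab).measurableSet
  have W_vol : volume W = ∏ i, ENNReal.ofReal (2 * c i) := by
    have box : (volume (Set.Icc (-Fin.tail c) (Fin.tail c)) : ENNReal) =
        ∏ i : Fin m, ENNReal.ofReal (2 * c i.succ) := by
      rw [Real.volume_Icc_pi]
      exact Finset.prod_congr rfl fun i _ => by simp [Fin.tail, two_mul]
    rw [Measure.volume_eq_prod, Measure.prod_apply_symm W_meas, Fin.prod_univ_succ, ← box,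
      ← setLIntegral_const, ← lintegral_indicator measurableSet_Icc]
    refine lintegral_congr fun y => ?_
    by_cases hy : y ∈ Set.Icc (-Fin.tail c) (Fin.tail c)
    · rw [Set.indicator_of_mem hy]
      have : (fun x => (x, y)) ⁻¹' W = Set.Icc (-(∑ i, Fin.tail t i * y i) / ρ - c 0)
          (-(∑ i, Fin.tail t i * y i) / ρ + c 0) := by
        ext x
        have hrρ : r = ρ * c 0 := by rw [hρ]; field_simp
        have hy' : ∀ i, |y i| ≤ Fin.tail c i := fun i => abs_le.2 ⟨hy.1 i, hy.2 i⟩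
        simp only [W, boxSlab, Set.mem_preimage, Set.mem_ofPred_eq, Set.mem_Icc, hy', implies_true,
          true_and]
        rw [abs_le]
        rw [sub_le_iff_le_add, ← sub_le_iff_le_add (a := x), div_le_iff₀ ρ_pos, le_div_iff₀ ρ_pos,
          hrρ]
        constructor <;> rintro ⟨h₁, h₂⟩ <;> constructor <;> nlinarith
      rw [this, Real.volume_Icc]
      congr 1
      ring
    · rw [Set.indicator_of_notMem hy]
      convert measure_empty (μ := volume) using 2
      ext x
      simp only [Set.mem_preimage, Set.mem_empty_iff_false, iff_false]
      exact fun hx => hy ⟨fun i => (abs_le.1 (hx.1 i)).1, fun i => (abs_le.1 (hx.1 i)).2⟩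
  rw [← W_vol, Measure.volume_eq_prod, Measure.prod_apply W_meas,
    volume_eq_lintegral_cons (isClosed_boxSlab _ _ _ _).measurableSet]
  refine lintegral_mono fun x => ?_
  by_cases hx : |x| ≤ (m + 1 : ℕ) * c 0
  · have : {y : Fin m → ℝ | (Fin.cons x y : Fin (m + 1) → ℝ) ∈
        boxSlab (Function.update c 0 ((m + 1 : ℕ) * c 0)) t r 0} =
        boxSlab (Fin.tail c) (Fin.tail t) r (t 0 * x) := by
      ext y
      simp only [boxSlab, Set.mem_ofPred_eq, Fin.forall_fin_succ, Fin.sum_univ_succ, Fin.cons_zero,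
        Fin.cons_succ, Fin.tail, Function.update_self, hx, true_and, add_zero,
        Function.update_of_ne (Fin.succ_ne_zero _)]
      rw [add_comm (t 0 * x)]
    rw [this]
    refine volume_boxSlab_le_of_abs_le (s' := ρ * x) _ _ _ ?_
    rw [abs_mul, abs_mul, abs_of_pos ρ_pos]
    gcongr
    rw [hρ, le_div_iff₀ hc0]
    exact htc 0
  · refine (le_of_eq ?_).trans zero_le
    convert measure_empty (μ := volume) using 2
    ext y
    simp only [Set.mem_preimage, Set.mem_empty_iff_false, iff_false]
    intro hy
    apply hx
    have sum_le : |∑ i, Fin.tail t i * y i| ≤ m * r := by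
      refine (Finset.abs_sum_le_sum_abs _ _).trans ((Finset.sum_le_card_nsmul _ _ r ?_).trans ?_)
      · intro i _
        rw [abs_mul]
        exact (mul_le_mul_of_nonneg_left (hy.1 i) (abs_nonneg _)).trans (htc i.succ)
      · simp
    have hrρ : r = ρ * c 0 := by rw [hρ]; field_simp
    have bound : |ρ * x| ≤ (m + 1) * r := by
      have h₁ := abs_le.1 hy.2
      have h₂ := abs_le.1 sum_le
      exact abs_le.2 ⟨by linarith, by linarith⟩
    rw [abs_mul, abs_of_pos ρ_pos, hrρ] at bound
    push_cast
    refine le_of_mul_le_mul_left ?_ ρ_pos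
    linarith

/-- Projecting the hyperplane `∑ i, t i * z i = 0` along a coordinate `k` that maximizes
`|t k| * c k`, the section of the box with half-sides `n * c 0, c 1, …, c n` covers at least the
volume of the face of the box with half-sides `c i`. -/
lemma prod_succAbove_le_volume_boxSlab {n : ℕ} {c t : Fin (n + 1) → ℝ} {k : Fin (n + 1)}
    (hc : ∀ i, 0 < c i) (htk : t k ≠ 0) (hk : ∀ i, |t i| * c i ≤ |t k| * c k) :
    ∏ i : Fin n, ENNReal.ofReal (2 * c (k.succAbove i)) ≤
      volume (boxSlab (fun i => Function.update c 0 (n * c 0) (k.succAbove i))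
        (fun i => t (k.succAbove i)) (|t k| * Function.update c 0 (n * c 0) k) 0) := by
  cases k using Fin.cases with
  | zero =>
    simp only [Fin.zero_succAbove, Function.update_self,
      Function.update_of_ne (Fin.succ_ne_zero _)]
    have box : volume (Set.Icc (fun i : Fin n => -c i.succ) fun i => c i.succ) =
        ∏ i : Fin n, ENNReal.ofReal (2 * c i.succ) := by
      rw [Real.volume_Icc_pi]
      exact Finset.prod_congr rfl fun i _ => by simp [two_mul]
    rw [← box]
    refine measure_mono fun y hy => ?_
    have hy' : ∀ i, |y i| ≤ c i.succ := fun i => abs_le.2 ⟨hy.1 i, hy.2 i⟩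
    refine ⟨hy', ?_⟩
    rw [add_zero]
    refine (Finset.abs_sum_le_sum_abs _ _).trans
      ((Finset.sum_le_card_nsmul _ _ (|t 0| * c 0) ?_).trans (le_of_eq ?_))
    · intro i _
      rw [abs_mul]
      exact (mul_le_mul_of_nonneg_left (hy' i) (abs_nonneg _)).trans (hk i.succ)
    · simp only [Finset.card_univ, Fintype.card_fin, nsmul_eq_mul]
      ring
  | succ j =>
    cases n with
    | zero => exact j.elim0
    | succ m =>
      have key := prod_le_volume_stretched_boxSlab (c := fun i => c (j.succ.succAbove i))
        (t := fun i => t (j.succ.succAbove i)) (r := |t j.succ| * c j.succ)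
        (mul_pos (abs_pos.2 htk) (hc _)) (fun i => hc _) fun i => hk _
      convert key using 4
      · rename_i i
        cases i using Fin.cases with
        | zero => simp
        | succ i => simp
      · simp

/-- **Minkowski's convex body theorem** for the image of the integer lattice under a matrix. -/
lemma exists_int_mulVec_mem_of_lt_volume {ι : Type*} [Fintype ι] [DecidableEq ι]
    {A : Matrix ι ι ℝ} (hA : A.det ≠ 0) {B : Set (ι → ℝ)} (hsymm : ∀ x ∈ B, -x ∈ B)
    (hconv : Convex ℝ B)
    (hvol : ENNReal.ofReal |A.det| * 2 ^ Fintype.card ι < volume B) :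
    ∃ v : ι → ℤ, v ≠ 0 ∧ A *ᵥ (fun j => (v j : ℝ)) ∈ B := by
  have hdet : LinearMap.det (Matrix.toLin' A) ≠ 0 := by rwa [LinearMap.det_toLin']
  have hpos : 0 < |A.det| := abs_pos.2 hA
  have : Countable (Submodule.span ℤ (Set.range (Pi.basisFun ℝ ι))).toAddSubgroup :=
    inferInstanceAs (Countable (Submodule.span ℤ (Set.range (Pi.basisFun ℝ ι))))
  obtain ⟨x, hx, hxB⟩ := exists_ne_zero_mem_lattice_of_measure_mul_two_pow_lt_measure
    (s := Matrix.toLin' A ⁻¹' B) (ZSpan.isAddFundamentalDomain' (Pi.basisFun ℝ ι) volume)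
    (fun x hx => by simpa [Matrix.mulVec_neg] using hsymm _ hx)
    (hconv.linear_preimage _) (by
      rw [Measure.addHaar_preimage_linearMap _ hdet, LinearMap.det_toLin',
        ZSpan.fundamentalDomain_pi_basisFun, Real.volume_pi_Ico, abs_inv,
        ENNReal.ofReal_inv_of_pos hpos, ← ENNReal.div_eq_inv_mul,
        ENNReal.lt_div_iff_mul_lt (by simp [hA]) (by simp)]
      simpa [mul_comm] using hvol)
  have hint := (Pi.basisFun ℝ ι).mem_span_iff_repr_mem ℤ (x : ι → ℝ) |>.1 x.2
  choose v hv using hint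
  have hvx : (fun j => (v j : ℝ)) = (x : ι → ℝ) := by
    ext j
    simpa using hv j
  refine ⟨v, ?_, ?_⟩
  · rintro rfl
    apply hx
    ext j
    simpa using (congrFun hvx j).symm
  · rw [hvx]
    simpa using hxB

lemma det_one_updateRow {ι R : Type*} [Fintype ι] [DecidableEq ι] [CommRing R] (k : ι)
    (t : ι → R) : ((1 : Matrix ι ι R).updateRow k t).det = t k := by
  rw [← Matrix.cramer_transpose_apply, Matrix.transpose_one, Matrix.cramer_one]
  rfl

lemma finite_setOf_abs_mulVec_le {ι : Type*} [Fintype ι] [DecidableEq ι]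
    {A : Matrix ι ι ℝ} (hA : A.det ≠ 0) (c : ι → ℝ) :
    {v : ι → ℤ | ∀ i, |(A *ᵥ fun j => (v j : ℝ)) i| ≤ c i}.Finite := by
  set N : ι → ℤ := fun j => ⌈∑ i, |A⁻¹ j i| * c i⌉
  refine (Set.finite_Icc (-N) N).subset fun v hv => ?_
  have bound (j : ι) : |(v j : ℝ)| ≤ N j := by
    have hv' : A⁻¹ *ᵥ (A *ᵥ fun j => (v j : ℝ)) = fun j => (v j : ℝ) := by
      rw [Matrix.mulVec_mulVec, Matrix.nonsing_inv_mul _ (isUnit_iff_ne_zero.2 hA),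
        Matrix.one_mulVec]
    rw [← congrFun hv' j]
    refine (Finset.abs_sum_le_sum_abs _ _).trans
      ((Finset.sum_le_sum fun i _ => ?_).trans (Int.le_ceil _))
    rw [abs_mul]
    exact mul_le_mul_of_nonneg_left (hv i) (abs_nonneg _)
  exact ⟨fun j => by exact_mod_cast (abs_le.1 (bound j)).1,
    fun j => by exact_mod_cast (abs_le.1 (bound j)).2⟩

/-- If a system of inequalities with bounds `x * w i` has a nonzero integer solution for every
`x > a`, then it has one for `x = a`. -/
lemma exists_int_abs_mulVec_le_of_forall_gt {ι : Type*} [Fintype ι] [DecidableEq ι]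
    {A : Matrix ι ι ℝ} (hA : A.det ≠ 0) {w : ι → ℝ} (hw : ∀ i, 0 ≤ w i) {a : ℝ}
    (h : ∀ x > a, ∃ v : ι → ℤ, v ≠ 0 ∧ ∀ i, |(A *ᵥ fun j => (v j : ℝ)) i| ≤ x * w i) :
    ∃ v : ι → ℤ, v ≠ 0 ∧ ∀ i, |(A *ᵥ fun j => (v j : ℝ)) i| ≤ a * w i := by
  by_contra! hcon
  have hfin := finite_setOf_abs_mulVec_le hA fun i => (a + 1) * w i
  have fails : ∀ v ∈ {v : ι → ℤ | ∀ i, |(A *ᵥ fun j => (v j : ℝ)) i| ≤ (a + 1) * w i},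
      ∀ᶠ x in nhdsWithin a (Set.Ioi a), v ≠ 0 →
        ∃ i, x * w i < |(A *ᵥ fun j => (v j : ℝ)) i| := by
    intro v _
    rcases eq_or_ne v 0 with rfl | hv
    · simp
    obtain ⟨i, hi⟩ := hcon v hv
    have : ContinuousAt (fun x : ℝ => x * w i) a := by fun_prop
    filter_upwards [nhdsWithin_le_nhds (this.eventually_lt_const hi)] with x hx _ using ⟨i, hx⟩
  obtain ⟨x, hx, hxa, hxa'⟩ := ((hfin.eventually_all.2 fails).and
    (Ioc_mem_nhdsGT (lt_add_one a))).exists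
  obtain ⟨v, hv, hvx⟩ := h x hxa
  obtain ⟨i, hi⟩ := hx v (fun i => (hvx i).trans (mul_le_mul_of_nonneg_right hxa' (hw i))) hv
  exact (hvx i).not_gt hi

/-- Transference with a strict inequality on the volume. -/
lemma exists_int_transpose_inv_mulVec_le {n : ℕ} {M : Matrix (Fin (n + 1)) (Fin (n + 1)) ℝ}
    (hM : M.det ≠ 0) {u : Fin (n + 1) → ℤ} (hu : u ≠ 0) {c : Fin (n + 1) → ℝ} (hc : ∀ i, 0 < c i)
    (hprod : ∀ k, |(M *ᵥ fun j => (u j : ℝ)) k| < |M.det| * ∏ i : Fin n, c (k.succAbove i)) :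
    ∃ v : Fin (n + 1) → ℤ, v ≠ 0 ∧ ∀ i,
      |((Mᵀ)⁻¹ *ᵥ fun j => (v j : ℝ)) i| ≤ Function.update c 0 (n * c 0) i := by
  set t := M *ᵥ fun j => (u j : ℝ) with ht
  obtain ⟨k, hk⟩ := Finite.exists_max fun i => |t i| * c i
  have htk : t k ≠ 0 := by
    intro h0
    have ht0 : t = 0 := by
      ext i
      have := hk i
      rw [h0, abs_zero, zero_mul] at this
      exact abs_nonpos_iff.1 (nonpos_of_mul_nonpos_left this (hc i))
    have hu0 := Matrix.eq_zero_of_mulVec_eq_zero hM ht0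
    exact hu (funext fun j => by simpa using congrFun hu0 j)
  set b := Function.update c 0 (n * c 0)
  set D := boxSlab (fun i => b (k.succAbove i)) (fun i => t (k.succAbove i)) (|t k| * b k) 0
    with hD
  set A := (1 : Matrix (Fin (n + 1)) (Fin (n + 1)) ℝ).updateRow k t * (Mᵀ)⁻¹ with hAdef
  have hMT : IsUnit (Mᵀ).det := by rwa [Matrix.det_transpose, isUnit_iff_ne_zero]
  have hAdet : A.det = t k / M.det := by
    rw [hAdef, Matrix.det_mul, det_one_updateRow, Matrix.det_nonsing_inv, Matrix.det_transpose,
      Ring.inverse_eq_inv', div_eq_mul_inv]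
  have hA : A.det ≠ 0 := hAdet ▸ div_ne_zero htk hM
  have mem_D (y : Fin n → ℝ) : y ∈ D ↔ (∀ i, |y i| ≤ b (k.succAbove i)) ∧
      |∑ i, t (k.succAbove i) * y i| ≤ |t k| * b k := by
    rw [hD, boxSlab, Set.mem_ofPred_eq, add_zero]
  have D_conv : Convex ℝ D := by
    have : D = (⋂ i, (LinearMap.proj i : (Fin n → ℝ) →ₗ[ℝ] ℝ) ⁻¹'
        Set.Icc (-b (k.succAbove i)) (b (k.succAbove i))) ∩
        (∑ i, t (k.succAbove i) • LinearMap.proj i : (Fin n → ℝ) →ₗ[ℝ] ℝ) ⁻¹'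
          Set.Icc (-(|t k| * b k)) (|t k| * b k) := by
      ext y
      rw [mem_D]
      simp [abs_le]
    rw [this]
    exact (convex_iInter fun i => (convex_Icc _ _).linear_preimage _).inter
      ((convex_Icc _ _).linear_preimage _)
  set B : Set (Fin (n + 1) → ℝ) := {z | |z k| < 1 ∧ k.removeNth z ∈ D} with hB
  have B_conv : Convex ℝ B := by
    intro x hx y hy p q hp hq hpq
    refine ⟨?_, D_conv hx.2 hy.2 hp hq hpq⟩
    have := convex_Ioo (-1 : ℝ) 1 (abs_lt.1 hx.1) (abs_lt.1 hy.1) hp hq hpq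
    exact abs_lt.2 this
  have B_symm : ∀ x ∈ B, -x ∈ B := by
    intro x hx
    refine ⟨by simpa using hx.1, (mem_D _).2 ?_⟩
    have := (mem_D _).1 hx.2
    simpa [Fin.removeNth, Finset.sum_neg_distrib] using this
  have B_vol : volume B = 2 * volume D := by
    have : B = MeasurableEquiv.piFinSuccAbove (fun _ => ℝ) k ⁻¹' (Set.Ioo (-1) 1 ×ˢ D) := by
      ext z
      simp [hB, MeasurableEquiv.piFinSuccAbove, Fin.insertNthEquiv, abs_lt]
    rw [this, (volume_preserving_piFinSuccAbove (fun _ => ℝ) k).measure_preimage_equiv,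
      Measure.volume_eq_prod, Measure.prod_prod, Real.volume_Ioo]
    norm_num
  obtain ⟨v, hv, hvB⟩ := exists_int_mulVec_mem_of_lt_volume hA B_symm B_conv (by
    have hlow := prod_succAbove_le_volume_boxSlab hc htk hk
    have hdpos : 0 < |M.det| := abs_pos.2 hM
    rw [B_vol, Fintype.card_fin, pow_succ', mul_left_comm]
    refine ENNReal.mul_lt_mul_right two_ne_zero ENNReal.ofNat_ne_top (lt_of_lt_of_le ?_ hlow)
    rw [← ENNReal.ofReal_prod_of_nonneg fun i _ => by have := hc (k.succAbove i); positivity,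
      Finset.prod_mul_distrib, Finset.prod_const, Finset.card_univ, Fintype.card_fin, hAdet,
      ← ENNReal.ofReal_ofNat, ← ENNReal.ofReal_pow zero_le_two,
      ← ENNReal.ofReal_mul (abs_nonneg _), mul_comm, abs_div]
    have : |t k| / |M.det| < ∏ i : Fin n, c (k.succAbove i) := by
      rw [div_lt_iff₀ hdpos, mul_comm]
      exact hprod k
    refine (ENNReal.ofReal_lt_ofReal_iff_of_nonneg (by positivity)).2 ?_
    gcongr)
  refine ⟨v, hv, ?_⟩
  set w := (Mᵀ)⁻¹ *ᵥ fun j => (v j : ℝ) with hw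
  have pairing : t ⬝ᵥ w = ((∑ j, u j * v j : ℤ) : ℝ) := by
    rw [ht, ← Matrix.vecMul_transpose, ← Matrix.dotProduct_mulVec, hw, Matrix.mulVec_mulVec,
      Matrix.mul_nonsing_inv _ hMT, Matrix.one_mulVec]
    simp [dotProduct]
  have Av : A *ᵥ (fun j => (v j : ℝ)) = Function.update w k (t ⬝ᵥ w) := by
    rw [hAdef, ← Matrix.mulVec_mulVec, ← hw]
    ext i
    rcases eq_or_ne i k with rfl | hi
    · simp [Matrix.mulVec]
    · simp [Matrix.mulVec, hi, Matrix.one_eq_pi_single]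
  rw [Av] at hvB
  obtain ⟨hvk, hvD⟩ := hvB
  rw [mem_D] at hvD
  simp only [Function.update_self, Fin.removeNth, Fin.succAbove_ne, ne_eq, not_false_eq_true,
    Function.update_of_ne] at hvk hvD
  have pairing_zero : t ⬝ᵥ w = 0 := by
    rw [pairing] at hvk ⊢
    exact_mod_cast Int.abs_lt_one_iff.1 (by exact_mod_cast hvk)
  intro i
  cases i using k.succAboveCases with
  | x =>
    rw [dotProduct, Fin.sum_univ_succAbove _ k] at pairing_zero
    have := hvD.2
    rw [← abs_neg, ← eq_neg_of_add_eq_zero_left pairing_zero, abs_mul] at this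
    exact le_of_mul_le_mul_left this (abs_pos.2 htk)
  | p i => exact hvD.1 i

theorem stmt4 (n : ℕ) (hn : 1 ≤ n) (T : Fin (n + 1) → ℝ) (hT : ∀ i, 0 < T i)
    (M : Matrix (Fin (n + 1)) (Fin (n + 1)) ℝ) (hM : M.det ≠ 0)
    (ι : ℝ) (hι : ι = ((∏ i, T i) / |M.det|) ^ ((n : ℝ)⁻¹))
    (u : Fin (n + 1) → ℤ) (hu : u ≠ 0)
    (hsol : ∀ i, |M.mulVec (fun j => (u j : ℝ)) i| ≤ T i) :
    ∃ v : Fin (n + 1) → ℤ, v ≠ 0 ∧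
      |(Mᵀ)⁻¹.mulVec (fun j => (v j : ℝ)) 0| ≤ n * ι / T 0 ∧
      ∀ i : Fin (n + 1), i ≠ 0 →
        |(Mᵀ)⁻¹.mulVec (fun j => (v j : ℝ)) i| ≤ ι / T i := by
  have hdpos : 0 < |M.det| := abs_pos.2 hM
  have hTprod : 0 < ∏ i, T i := Finset.prod_pos fun i _ => hT i
  have hι0 : 0 ≤ ι := hι ▸ by positivity
  have hιn : ι ^ n = (∏ i, T i) / |M.det| := by
    rw [hι, Real.rpow_inv_natCast_pow (by positivity) (by omega)]
  have hdet : ((Mᵀ)⁻¹).det ≠ 0 := by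
    rw [Matrix.det_nonsing_inv, Matrix.det_transpose, Ring.inverse_eq_inv']
    exact inv_ne_zero hM
  obtain ⟨v, hv, hvle⟩ := exists_int_abs_mulVec_le_of_forall_gt hdet (a := ι)
    (w := Function.update (fun i => (T i)⁻¹) 0 (n * (T 0)⁻¹)) (fun i => by
      have := hT i
      rcases eq_or_ne i 0 with rfl | hi
      · rw [Function.update_self]; positivity
      · rw [Function.update_of_ne hi]; positivity) (fun x hx => by
      have hx0 : 0 < x := hι0.trans_lt hx
      obtain ⟨v, hv, hvle⟩ := exists_int_transpose_inv_mulVec_le hM hu (c := fun i => x / T i)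
        (fun i => div_pos hx0 (hT i)) (fun k => by
          refine (hsol k).trans_lt ?_
          have hpow : ι ^ n < x ^ n := pow_lt_pow_left₀ hx hι0 (by omega)
          rw [hιn, div_lt_iff₀ hdpos, Fin.prod_univ_succAbove _ k] at hpow
          rw [Finset.prod_div_distrib, Finset.prod_const, Finset.card_univ, Fintype.card_fin,
            ← mul_div_assoc, lt_div_iff₀ (Finset.prod_pos fun i _ => hT _), mul_comm |M.det|]
          exact hpow)
      refine ⟨v, hv, fun i => (hvle i).trans_eq ?_⟩
      rcases eq_or_ne i 0 with rfl | hi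
      · simp only [Function.update_self]; ring
      · simp only [Function.update_of_ne hi]; ring)
  refine ⟨v, hv, (hvle 0).trans_eq ?_, fun i hi => (hvle i).trans_eq ?_⟩
  · simp only [Function.update_self]; ring
  · simp only [Function.update_of_ne hi]; ring
end

section
/- With the notation of the context, let q ∈ ℕ and let I ⊆ I₀ be a closed interval with |I| = |I₀|·R^{−(q−1)} such that for every x ∈ I and every real Q with 1 ≤ Q < e^{β(q−1−λ₁)}, there is no nonzero (m, p₁,…,pₙ) ∈ ℤ^{n+1} with |m| ≤ Q and |m·φᵢ(x) − pᵢ| < (k₁/n)·Q^{−rᵢ} for all 1 ≤ i ≤ n. Then there is at most one v = p/m ∈ V_q, and for each such v at most two indices j ∈ {1,…,m⋆}, such that v ∈ V^{j,m} and Δ^{j,m}(v) ∩ I ≠ ∅. -/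
open Filter Set

/-- length of the pieces of the partition of `I₀ = [a,b]`:
`ℓ = c|I₀|/(2 d₁ m^{r₁})`. -/
noncomputable def pieceLen (c a b d₁ r₁ : ℝ) (m : ℕ) : ℝ :=
  c * (b - a) / (2 * d₁ * (m : ℝ) ^ r₁)

/-- `m⋆ = ⌈(2d₁/c) m^{r₁}⌉`. -/
noncomputable def mstar (c d₁ r₁ : ℝ) (m : ℕ) : ℕ :=
  ⌈(2 * d₁ / c) * (m : ℝ) ^ r₁⌉₊

/-- the `j`-th piece `I₀^{j,m}` (for `1 ≤ j ≤ m⋆`), the last one truncated at `b`. -/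
noncomputable def pieceI (c a b d₁ r₁ : ℝ) (m j : ℕ) : Set ℝ :=
  Icc (a + ((j : ℝ) - 1) * pieceLen c a b d₁ r₁ m)
    (min (a + (j : ℝ) * pieceLen c a b d₁ r₁ m) b)

/-- the center `x₀^{j,m}` of `I₀^{j,m}`. -/
noncomputable def pieceCenter (c a b d₁ r₁ : ℝ) (m j : ℕ) : ℝ :=
  ((a + ((j : ℝ) - 1) * pieceLen c a b d₁ r₁ m)
    + min (a + (j : ℝ) * pieceLen c a b d₁ r₁ m) b) / 2

/-- the dangerous domain `Δ^{j,m}(v)` (it only depends on `p₁ = p₀` here). -/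
noncomputable def deltaSet (θ₁ : ℝ → ℝ) (c a b d₁ r₁ : ℝ) (m j : ℕ) (p₀ : ℤ) : Set ℝ :=
  {x ∈ pieceI c a b d₁ r₁ m j | |x - ((p₀ : ℝ) + θ₁ x) / m| < c / (m : ℝ) ^ (1 + r₁)}

/-- `v = p/m ∈ V^{j,m}` (the paper's dimension `n ≥ 2` is `n + 2` here). -/
noncomputable def memV (n : ℕ) (bigI : Set ℝ) (φ : ℝ → Fin (n + 2) → ℝ)
    (θ : Fin (n + 2) → ℝ → ℝ) (d r : Fin (n + 2) → ℝ) (f₀ c a b : ℝ)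
    (m j : ℕ) (p : Fin (n + 2) → ℤ) : Prop :=
  ((p 0 : ℝ) + θ 0 (pieceCenter c a b (d 0) (r 0) m j)) / m ∈ bigI ∧
  ∀ i : Fin (n + 2), i ≠ 0 →
    |φ (((p 0 : ℝ) + θ 0 (pieceCenter c a b (d 0) (r 0) m j)) / m) i
      - ((p i : ℝ) + θ i (((p 0 : ℝ) + θ 0 (pieceCenter c a b (d 0) (r 0) m j)) / m)) / m|
    < (f₀ + d i) * c / (m : ℝ) ^ (1 + r i)

/-- `v = p/m ∈ V`. -/
noncomputable def memBigV (n : ℕ) (bigI : Set ℝ) (φ : ℝ → Fin (n + 2) → ℝ)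
    (θ : Fin (n + 2) → ℝ → ℝ) (d r : Fin (n + 2) → ℝ) (f₀ c a b : ℝ)
    (m : ℕ) (p : Fin (n + 2) → ℤ) : Prop :=
  17 * (b - a)⁻¹ * d 0 < (m : ℝ) ∧
  ∃ j : ℕ, 1 ≤ j ∧ j ≤ mstar c (d 0) (r 0) m ∧ memV n bigI φ θ d r f₀ c a b m j p

/-- `v = p/m ∈ V_q`. -/
noncomputable def memVq (n : ℕ) (bigI : Set ℝ) (φ : ℝ → Fin (n + 2) → ℝ)
    (θ : Fin (n + 2) → ℝ → ℝ) (d r : Fin (n + 2) → ℝ) (f₀ c a b R : ℝ)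
    (q m : ℕ) (p : Fin (n + 2) → ℤ) : Prop :=
  memBigV n bigI φ θ d r f₀ c a b m p ∧
  2 * c * (b - a)⁻¹ * R ^ (q + 1) ≤ (m : ℝ) ^ (1 + r 0) ∧
  (m : ℝ) ^ (1 + r 0) < 2 * c * (b - a)⁻¹ * R ^ (q + 2)

/-- Comparing `m φ(x) - p - θ(x)` with its value at a nearby point `y`, for Lipschitz `φ` and `θ`. -/
theorem abs_mul_sub_sub_le_of_lipschitz {φ θ : ℝ → ℝ} {F D m p δ ε x y : ℝ} (hF : 0 ≤ F)
    (hD : 0 ≤ D) (hm : 0 < m) (hφ : |φ x - φ y| ≤ F * |x - y|) (hθ : |θ x - θ y| ≤ D * |x - y|)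
    (hxy : |x - y| ≤ ε) (hy : |φ y - (p + θ y) / m| ≤ δ) :
    |m * φ x - p - θ x| ≤ m * δ + (m * F + D) * ε := by
  have h1 : m * φ x - p - θ x
      = m * (φ x - φ y) + m * (φ y - (p + θ y) / m) - (θ x - θ y) := by
    field_simp
    ring
  have h2 : |m * (φ x - φ y)| ≤ m * (F * ε) := by
    rw [abs_mul, abs_of_pos hm]
    gcongr
    exact hφ.trans (by gcongr)
  have h3 : |m * (φ y - (p + θ y) / m)| ≤ m * δ := by
    rw [abs_mul, abs_of_pos hm]
    gcongr
  have h4 : |θ x - θ y| ≤ D * ε := hθ.trans (by gcongr)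
  rw [h1]
  calc _ ≤ |m * (φ x - φ y)| + |m * (φ y - (p + θ y) / m)| + |θ x - θ y| :=
        (abs_sub _ _).trans (by gcongr; exact abs_add_le _ _)
    _ ≤ _ := by linarith

theorem pieceLen_pos {c a b d₁ r₁ : ℝ} {m : ℕ} (hc : 0 < c) (hab : a < b) (hd : 0 < d₁)
    (hm : 0 < m) : 0 < pieceLen c a b d₁ r₁ m := by
  have : 0 < b - a := sub_pos.2 hab
  have : (0 : ℝ) < m := by exact_mod_cast hm
  unfold pieceLen
  positivity

/-- The left endpoint of an admissible piece lies in `[a, b]`. -/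
theorem left_endpoint_le {c a b d₁ r₁ : ℝ} {m j : ℕ} (hc : 0 < c) (hab : a < b) (hd : 0 < d₁)
    (hm : 0 < m) (hj : j ≤ mstar c d₁ r₁ m) :
    a + ((j : ℝ) - 1) * pieceLen c a b d₁ r₁ m ≤ b := by
  have hm' : (0 : ℝ) < m := by exact_mod_cast hm
  have hl := pieceLen_pos (r₁ := r₁) hc hab hd hm
  have h1 : (j : ℝ) < (2 * d₁ / c) * (m : ℝ) ^ r₁ + 1 :=
    lt_of_le_of_lt (by exact_mod_cast hj) (Nat.ceil_lt_add_one (by positivity))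
  have h2 : ((2 * d₁ / c) * (m : ℝ) ^ r₁) * pieceLen c a b d₁ r₁ m = b - a := by
    have := (Real.rpow_pos_of_pos hm' r₁).ne'
    unfold pieceLen
    field_simp
  have h3 : ((j : ℝ) - 1) * pieceLen c a b d₁ r₁ m
      ≤ ((2 * d₁ / c) * (m : ℝ) ^ r₁) * pieceLen c a b d₁ r₁ m := by
    gcongr
    linarith
  linarith

theorem pieceCenter_mem_Icc {c a b d₁ r₁ : ℝ} {m j : ℕ} (hc : 0 < c) (hab : a < b) (hd : 0 < d₁)
    (hm : 0 < m) (hj1 : 1 ≤ j) (hj : j ≤ mstar c d₁ r₁ m) :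
    pieceCenter c a b d₁ r₁ m j ∈ Icc a b := by
  have hl := pieceLen_pos (r₁ := r₁) hc hab hd hm
  have h1 := left_endpoint_le hc hab hd hm hj
  have hj' : (1 : ℝ) ≤ j := by exact_mod_cast hj1
  have h2 : a ≤ a + ((j : ℝ) - 1) * pieceLen c a b d₁ r₁ m := by nlinarith
  have h3 : a ≤ a + (j : ℝ) * pieceLen c a b d₁ r₁ m := by nlinarith
  have h4 : a ≤ min (a + (j : ℝ) * pieceLen c a b d₁ r₁ m) b := le_min h3 hab.le
  have h5 := min_le_right (a + (j : ℝ) * pieceLen c a b d₁ r₁ m) b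
  unfold pieceCenter
  constructor <;> linarith

theorem abs_sub_pieceCenter_le {c a b d₁ r₁ x : ℝ} {m j : ℕ}
    (hx : x ∈ pieceI c a b d₁ r₁ m j) :
    |x - pieceCenter c a b d₁ r₁ m j| ≤ pieceLen c a b d₁ r₁ m / 2 := by
  obtain ⟨h1, h2⟩ := hx
  have h3 := min_le_left (a + (j : ℝ) * pieceLen c a b d₁ r₁ m) b
  unfold pieceCenter
  rw [abs_le]
  constructor <;> linarith

/-- Membership in `V^{j,m}` together with a point of `Δ^{j,m}(v)` in an interval `[lo, hi] ⊆ [a, b]`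
controls the inhomogeneous linear forms on the whole interval. -/
theorem abs_linear_form_le {n : ℕ} {r : Fin (n + 2) → ℝ} (hr_sorted : ∀ i, r i ≤ r 0)
    {a b : ℝ} (hab : a < b) (hlen : 3 * (b - a) ≤ 1) {bigI : Set ℝ} (hsub : Icc a b ⊆ bigI)
    {φ : ℝ → Fin (n + 2) → ℝ} (hφ_first : ∀ x ∈ bigI, φ x 0 = x)
    {f₀ : ℝ} (hf₀ : 1 ≤ f₀)
    (hφ_lip : ∀ i, ∀ x ∈ bigI, ∀ y ∈ bigI, |φ x i - φ y i| ≤ f₀ * |x - y|)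
    {θ : Fin (n + 2) → ℝ → ℝ} {d : Fin (n + 2) → ℝ} (hd : ∀ i, 0 < d i)
    (hθ_lip : ∀ i, ∀ x ∈ bigI, ∀ y ∈ bigI, |θ i x - θ i y| ≤ d i * |x - y|)
    {D : ℝ} (hD0 : 0 ≤ D) (hD : ∀ i, i ≠ 0 → d i ≤ D) {c : ℝ} (hc : 0 < c)
    {lo hi : ℝ} (hI_sub : Icc lo hi ⊆ Icc a b) {m j : ℕ} {p : Fin (n + 2) → ℤ}
    (hm : 17 * (b - a)⁻¹ * d 0 < (m : ℝ)) (hj1 : 1 ≤ j) (hj : j ≤ mstar c (d 0) (r 0) m)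
    (hV : memV n bigI φ θ d r f₀ c a b m j p)
    (hΔ : (deltaSet (θ 0) c a b (d 0) (r 0) m j (p 0) ∩ Icc lo hi).Nonempty)
    {x : ℝ} (hx : x ∈ Icc lo hi) (i : Fin (n + 2)) :
    |(m : ℝ) * φ x i - p i - θ i x|
      ≤ (f₀ + D) * (3 * (c * (m : ℝ) ^ (-(r i))) + 2 * (m * (hi - lo))) := by
  have hba : 0 < b - a := sub_pos.2 hab
  have hd0 := hd 0
  have hm0 : (0 : ℝ) < m := lt_trans (by positivity) hm
  have hmN : 0 < m := by exact_mod_cast hm0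
  have hm1 : (1 : ℝ) ≤ m := by exact_mod_cast hmN
  have hd0m : d 0 ≤ m := by
    have h1 : 3 ≤ (b - a)⁻¹ := by
      rw [le_inv_comm₀ (by norm_num) hba]
      linarith
    nlinarith
  obtain ⟨z, ⟨hzp, hz⟩, hzI⟩ := hΔ
  have hxB := hsub (hI_sub hx)
  have hzB := hsub (hI_sub hzI)
  have hL : 0 ≤ hi - lo := by linarith [hx.1, hx.2]
  have hxz : |x - z| ≤ hi - lo := by
    rw [abs_le]
    constructor <;> linarith [hx.1, hx.2, hzI.1, hzI.2]
  have hpow : ∀ s : ℝ, (m : ℝ) * (c / (m : ℝ) ^ (1 + s)) = c * (m : ℝ) ^ (-s) := by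
    intro s
    rw [Real.rpow_add hm0, Real.rpow_one, Real.rpow_neg hm0.le]
    have := (Real.rpow_pos_of_pos hm0 s).ne'
    field_simp
  have hP : 0 < c * (m : ℝ) ^ (-(r i)) := by positivity
  have hmL : 0 ≤ m * (hi - lo) := by positivity
  by_cases hi0 : i = 0
  · subst hi0
    have h1 := abs_mul_sub_sub_le_of_lipschitz (φ := fun t => t) (θ := θ 0) (F := 1) (D := d 0)
      (m := m) (p := p 0) (x := x) (y := z) zero_le_one hd0.le hm0 (by simp)
      (hθ_lip 0 x hxB z hzB) hxz hz.le
    rw [hφ_first x hxB]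
    rw [hpow] at h1
    refine h1.trans ?_
    have h2 : (m * 1 + d 0) * (hi - lo) ≤ 2 * (m * (hi - lo)) := by nlinarith
    have h3 : (1 : ℝ) ≤ f₀ + D := by linarith
    nlinarith
  · set x₀ := pieceCenter c a b (d 0) (r 0) m j with hx₀
    obtain ⟨hyB, hy⟩ := hV
    rw [← hx₀] at hyB hy
    set y := ((p 0 : ℝ) + θ 0 x₀) / m with hy_def
    have hx₀B : x₀ ∈ bigI := hsub (pieceCenter_mem_Icc hc hab hd0 hmN hj1 hj)
    have h1 : |z - y| ≤ 2 * (c / (m : ℝ) ^ (1 + r 0)) := by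
      have e : z - y = (z - ((p 0 : ℝ) + θ 0 z) / m) + (θ 0 z - θ 0 x₀) / m := by
        rw [hy_def]
        field_simp
        ring
      have h2 : |(θ 0 z - θ 0 x₀) / m| ≤ c / (m : ℝ) ^ (1 + r 0) := by
        rw [abs_div, abs_of_pos hm0, div_le_iff₀ hm0, mul_comm, hpow]
        calc _ ≤ d 0 * |z - x₀| := hθ_lip 0 z hzB x₀ hx₀B
          _ ≤ d 0 * (pieceLen c a b (d 0) (r 0) m / 2) := by
            gcongr
            exact abs_sub_pieceCenter_le hzp
          _ = (b - a) / 4 * (c * (m : ℝ) ^ (-(r 0))) := by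
            rw [Real.rpow_neg hm0.le]
            have := (Real.rpow_pos_of_pos hm0 (r 0)).ne'
            unfold pieceLen
            field_simp
            norm_num
          _ ≤ 1 * (c * (m : ℝ) ^ (-(r 0))) := by
            gcongr
            linarith
          _ = _ := one_mul _
      rw [e]
      linarith [abs_add_le (z - ((p 0 : ℝ) + θ 0 z) / m) ((θ 0 z - θ 0 x₀) / m)]
    have h2 : |x - y| ≤ 2 * (c / (m : ℝ) ^ (1 + r 0)) + (hi - lo) := by
      linarith [abs_sub_le x z y]
    have h3 := abs_mul_sub_sub_le_of_lipschitz (φ := fun t => φ t i) (θ := θ i) (F := f₀)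
      (D := d i) (m := m) (p := p i) (x := x) (y := y) (by linarith) (hd i).le hm0
      (hφ_lip i x hxB y hyB) (hθ_lip i x hxB y hyB) h2 (hy i hi0).le
    refine h3.trans ?_
    have h4 : (m : ℝ) * ((f₀ + d i) * c / (m : ℝ) ^ (1 + r i))
        = (f₀ + d i) * (c * (m : ℝ) ^ (-(r i))) := by
      rw [← hpow]
      ring
    have h5 : c * (m : ℝ) ^ (-(r 0)) ≤ c * (m : ℝ) ^ (-(r i)) := by
      have := hr_sorted i
      gcongr
    have h6 : (m : ℝ) * (2 * (c / (m : ℝ) ^ (1 + r 0)) + (hi - lo))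
        ≤ 2 * (c * (m : ℝ) ^ (-(r i))) + m * (hi - lo) := by
      rw [mul_add, mul_left_comm, hpow]
      linarith
    have hdi := hd i
    have h7 : 0 ≤ 2 * (c / (m : ℝ) ^ (1 + r 0)) + (hi - lo) := by positivity
    rw [h4]
    calc _ ≤ (f₀ + d i) * (c * (m : ℝ) ^ (-(r i)))
          + (m * f₀ + m * d i) * (2 * (c / (m : ℝ) ^ (1 + r 0)) + (hi - lo)) := by
          gcongr
          nlinarith
      _ = (f₀ + d i) * (c * (m : ℝ) ^ (-(r i))
          + m * (2 * (c / (m : ℝ) ^ (1 + r 0)) + (hi - lo))) := by ring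
      _ ≤ (f₀ + d i) * (3 * (c * (m : ℝ) ^ (-(r i))) + 2 * (m * (hi - lo))) := by
          refine mul_le_mul_of_nonneg_left ?_ (by linarith)
          linarith
      _ ≤ _ := by
          gcongr
          exact hD i hi0

/-- Two pieces both meeting `Δ(v)` are adjacent or equal. -/
theorem index_le_succ {θ₁ : ℝ → ℝ} {c a b d₁ r₁ : ℝ} (hab : a < b) (hlen : 3 * (b - a) ≤ 1)
    (hc : 0 < c) (hd : 0 < d₁) {m : ℕ} (hm : 17 * (b - a)⁻¹ * d₁ < (m : ℝ)) {p₀ : ℤ}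
    {j j' : ℕ} {x x' : ℝ} (hθ : |θ₁ x - θ₁ x'| ≤ d₁ * |x - x'|)
    (hx : x ∈ deltaSet θ₁ c a b d₁ r₁ m j p₀) (hx' : x' ∈ deltaSet θ₁ c a b d₁ r₁ m j' p₀) :
    j' ≤ j + 1 := by
  by_contra! hjj
  have hba : 0 < b - a := sub_pos.2 hab
  have hm0 : (0 : ℝ) < m := lt_trans (by positivity) hm
  have hmN : 0 < m := by exact_mod_cast hm0
  have hl := pieceLen_pos (r₁ := r₁) hc hab hd hmN
  obtain ⟨⟨-, hx1⟩, hx2⟩ := hx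
  obtain ⟨⟨hx1', -⟩, hx2'⟩ := hx'
  have hx3 := hx1.trans (min_le_left _ _)
  have hj : (j : ℝ) + 2 ≤ j' := by exact_mod_cast hjj
  have h1 : pieceLen c a b d₁ r₁ m ≤ |x - x'| := by
    rw [abs_sub_comm]
    refine le_trans ?_ (le_abs_self _)
    nlinarith
  have hm17 : 17 * d₁ < m * (b - a) := by
    have := mul_lt_mul_of_pos_right hm hba
    field_simp at this
    linarith
  set t := c / (m : ℝ) ^ (1 + r₁) with ht
  have ht0 : 0 < t := by positivity
  have hlt : pieceLen c a b d₁ r₁ m * (2 * d₁) = t * (m * (b - a)) := by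
    have := (Real.rpow_pos_of_pos hm0 r₁).ne'
    rw [ht, Real.rpow_add hm0, Real.rpow_one]
    unfold pieceLen
    field_simp
  have h2 : |x - x'| ≤ 2 * t + |x - x'| / 2 := by
    have e : x - x' = (x - (p₀ + θ₁ x) / m) - (x' - (p₀ + θ₁ x') / m) + (θ₁ x - θ₁ x') / m := by
      field_simp
      ring
    have h3 : |(θ₁ x - θ₁ x') / m| ≤ |x - x'| / 2 := by
      rw [abs_div, abs_of_pos hm0, div_le_iff₀ hm0]
      refine hθ.trans ?_
      have : 2 * d₁ ≤ m := by nlinarith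
      nlinarith [abs_nonneg (x - x')]
    have h4 := abs_add_le ((x - (p₀ + θ₁ x) / m) - (x' - (p₀ + θ₁ x') / m)) ((θ₁ x - θ₁ x') / m)
    have h5 := abs_sub (x - (p₀ + θ₁ x) / m) (x' - (p₀ + θ₁ x') / m)
    rw [← e] at h4
    linarith
  have h6 : pieceLen c a b d₁ r₁ m ≤ 4 * t := by linarith
  nlinarith

theorem encard_le_two_of_forall_le_succ {S : Set ℕ} (h : ∀ j ∈ S, ∀ j' ∈ S, j' ≤ j + 1) :
    S.encard ≤ 2 := by
  rcases S.eq_empty_or_nonempty with rfl | hS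
  · simp
  · have hsub : S ⊆ {sInf S, sInf S + 1} := by
      intro j hj
      have h1 := h _ (Nat.sInf_mem hS) j hj
      have h2 := Nat.sInf_le hj
      simp only [mem_insert_iff, mem_singleton_iff]
      omega
    exact (encard_le_encard hsub).trans (by
      have := encard_insert_le {sInf S + 1} (sInf S)
      rwa [encard_singleton, one_add_one_eq_two] at this)

/-- A function differentiable on a compact interval with continuous derivatives is Lipschitz, with
constant dominating the supremum of the derivatives of all the coordinates. -/
theorem abs_sub_le_one_add_sSup {k : ℕ} {u v : ℝ} {φ φd : ℝ → Fin k → ℝ}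
    (hφ : ∀ i, ∀ x ∈ Icc u v, HasDerivWithinAt (fun t => φ t i) (φd x i) (Icc u v) x)
    (hcont : ∀ i, ContinuousOn (fun x => φd x i) (Icc u v)) (i : Fin k)
    {x y : ℝ} (hx : x ∈ Icc u v) (hy : y ∈ Icc u v) :
    |φ x i - φ y i|
      ≤ (1 + sSup {z | ∃ x ∈ Icc u v, ∃ i : Fin k, z = |φd x i|}) * |x - y| := by
  have hbdd : BddAbove {z | ∃ x ∈ Icc u v, ∃ i : Fin k, z = |φd x i|} := by
    choose C hC using fun i => isCompact_Icc.exists_bound_of_continuousOn (hcont i)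
    refine ⟨∑ i, |C i|, ?_⟩
    rintro _ ⟨x, hx, i, rfl⟩
    exact ((hC i x hx).trans (le_abs_self _)).trans
      (Finset.single_le_sum (f := fun i => |C i|) (fun _ _ => abs_nonneg _) (Finset.mem_univ i))
  have h := (convex_Icc u v).norm_image_sub_le_of_norm_hasDerivWithin_le (hφ i)
    (C := 1 + sSup {z | ∃ x ∈ Icc u v, ∃ i : Fin k, z = |φd x i|}) (fun z hz => ?_) hy hx
  · simpa [Real.norm_eq_abs] using h
  · rw [Real.norm_eq_abs]
    linarith [le_csSup hbdd ⟨z, hz, i, rfl⟩]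

/-- If `m < Q` are comparable up to a factor `R`, the error terms in `m` become error terms
in `Q`. -/
theorem error_le_of_scale {c R Q m s t L : ℝ} (hc : 0 < c) (hR : 1 ≤ R) (hm : 1 ≤ m)
    (hmQ : m ≤ Q) (hs : 0 < s) (ht : 0 < t) (ht1 : t ≤ 1) (hts : t ≤ s) (hL : 0 ≤ L)
    (hQm : Q ^ (1 + s) ≤ R * m ^ (1 + s)) (hQL : Q ^ (1 + s) * L = 2 * c * R ^ 3) :
    3 * (c * m ^ (-t)) + 2 * (m * L) ≤ 7 * (c * R ^ 3 * Q ^ (-t)) := by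
  have hm0 : 0 < m := by linarith
  have hQ0 : 0 < Q := by linarith
  have hQ1 : 1 ≤ Q := hm.trans hmQ
  have h1 : Q ≤ R * m := by
    have h : Q ^ (1 + s) ≤ (R * m) ^ (1 + s) := by
      rw [Real.mul_rpow (by linarith) hm0.le]
      refine hQm.trans ?_
      gcongr
      exact Real.self_le_rpow_of_one_le hR (by linarith)
    exact (Real.rpow_le_rpow_iff hQ0.le (by positivity) (by linarith)).1 h
  have h2 : m ^ (-t) ≤ R ^ 3 * Q ^ (-t) := by
    rw [Real.rpow_neg hm0.le, Real.rpow_neg hQ0.le, ← div_eq_mul_inv, inv_eq_one_div,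
      div_le_div_iff₀ (by positivity) (by positivity), one_mul]
    calc Q ^ t ≤ (R * m) ^ t := by gcongr
      _ = R ^ t * m ^ t := Real.mul_rpow (by linarith) hm0.le
      _ ≤ R ^ 3 * m ^ t := by
        gcongr
        rw [← Real.rpow_natCast]
        gcongr
        · push_cast
          linarith
  have h3 : Q * L = 2 * c * R ^ 3 * Q ^ (-s) := by
    rw [← hQL, mul_right_comm, ← Real.rpow_add hQ0]
    simp
  have h4 : m * L ≤ 2 * c * R ^ 3 * Q ^ (-t) := by
    calc m * L ≤ Q * L := by gcongr
      _ = _ := h3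
      _ ≤ _ := by
        gcongr
  have h5 : c * m ^ (-t) ≤ c * (R ^ 3 * Q ^ (-t)) := by gcongr
  linarith

/-- The upper bound for the denominators in `V_q` lies below the threshold `e^{β(q-1-λ)}`. -/
theorem rpow_inv_lt_exp {c w R β s k lam : ℝ} (q : ℕ) (hc : 0 < c) (hR : 1 < R) (hw0 : 0 ≤ w) (hw : w < R)
    (hs : 0 < s) (hβ : β * (1 + s) = Real.log R) (hk0 : 0 < k) (hk : k ≤ Real.exp (-β * lam))
    (hck : 2 * (c * R ^ 4) ≤ k ^ (1 + s)) :
    (2 * c * w * R ^ (q + 2)) ^ (1 + s)⁻¹ < Real.exp (β * ((q : ℝ) - 1 - lam)) := by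
  have hR0 : 0 < R := by linarith
  have h1 : Real.exp (β * ((q : ℝ) - 1 - lam) * (1 + s)) * R
      = Real.exp (-β * lam * (1 + s)) * R ^ q := by
    have e1 : R ^ q = Real.exp (Real.log R * q) := by
      rw [← Real.rpow_natCast, Real.rpow_def_of_pos hR0]
    have e2 : R = Real.exp (Real.log R) := (Real.exp_log hR0).symm
    calc _ = Real.exp (β * ((q : ℝ) - 1 - lam) * (1 + s)) * Real.exp (Real.log R) := by rw [← e2]
      _ = _ := by
        rw [e1, ← Real.exp_add, ← Real.exp_add, ← hβ]
        ring_nf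
  have h2 : k ^ (1 + s) ≤ Real.exp (-β * lam * (1 + s)) := by
    rw [Real.exp_mul]
    gcongr
  have h3 : 2 * c * w * R ^ (q + 2) * R
      < Real.exp (β * ((q : ℝ) - 1 - lam) * (1 + s)) * R := by
    rw [h1]
    calc _ < 2 * c * R * R ^ (q + 2) * R := by gcongr
      _ = 2 * (c * R ^ 4) * R ^ q := by ring
      _ ≤ _ := by
        gcongr
        exact hck.trans h2
  have h4 := lt_of_mul_lt_mul_right h3 hR0.le
  rw [Real.exp_mul] at h4
  rwa [Real.rpow_inv_lt_iff_of_pos (by positivity) (Real.exp_pos _).le (by linarith)]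

/- STATEMENT 12: Proposition `key`: an interval `I ∈ 𝒥_{q-1}` meets the
dangerous domains of at most one `v = p/m ∈ V_q`, and for each such `v` of at
most two indices `j`. The paper's dimension `n ≥ 2` is `n + 2` below. -/

set_option maxHeartbeats 1000000 in
theorem stmt12 (n : ℕ) (r : Fin (n + 2) → ℝ)
    (hr_pos : ∀ i, 0 < r i) (hr_sorted : ∀ i j : Fin (n + 2), i ≤ j → r j ≤ r i)
    (hr_sum : ∑ i, r i = 1)
    (a b : ℝ) (hab : a < b) (hlen : 3 * (b - a) ≤ 1)
    (R : ℝ) (hR : max 1 (b - a)⁻¹ < R)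
    (β : ℝ) (hβ : β = Real.log R / (1 + r 0))
    (ξ : ℝ) (hξ_pos : 0 < ξ) (hξ : ξ < ((n : ℝ) + 3) / Real.exp 1)
    (lam1 : ℤ)
    (hlam1 : lam1 = ⌈Real.log (((n : ℝ) + 3) / ξ) / (β * r (Fin.last (n + 1)))⌉)
    (k₁ : ℝ) (hk₁ : k₁ = ξ / ((n : ℝ) + 3) * Real.exp (-β * lam1))
    (bigI : Set ℝ)
    (hbigI : bigI = Icc ((a + b) / 2 - (3 : ℝ) ^ (n + 3) * (b - a) / 2)
      ((a + b) / 2 + (3 : ℝ) ^ (n + 3) * (b - a) / 2))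
    (φ φd : ℝ → Fin (n + 2) → ℝ)
    (hφ_diff : ∀ (i : Fin (n + 2)), ∀ x ∈ bigI,
      HasDerivWithinAt (fun t => φ t i) (φd x i) bigI x)
    (hφd_cont : ∀ i : Fin (n + 2), ContinuousOn (fun x => φd x i) bigI)
    (hφ_first : ∀ x ∈ bigI, φ x 0 = x)
    (f₀ : ℝ) (hf₀ : f₀ = 1 + sSup {y | ∃ x ∈ bigI, ∃ i : Fin (n + 2), y = |φd x i|})
    (θ : Fin (n + 2) → ℝ → ℝ) (d : Fin (n + 2) → ℝ) (hd : ∀ i, 0 < d i)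
    (hθ_lip : ∀ i, ∀ x ∈ bigI, ∀ y ∈ bigI, |θ i x - θ i y| ≤ d i * |x - y|)
    (dmax2 : ℝ) (hdmax2 : dmax2 = sSup {y | ∃ i : Fin (n + 2), i ≠ 0 ∧ y = d i})
    (c : ℝ)
    (hc : c = k₁ ^ (1 + r 0) * d 0
      / (200 * ((n : ℝ) + 2) * (f₀ + dmax2) * (1 + d 0) ^ 2 * R ^ 4))
    (q : ℕ) (lo hi : ℝ) (hI_sub : Icc lo hi ⊆ Icc a b)
    (hI_len : hi - lo = (b - a) * R ^ (1 - (q : ℤ)))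
    -- no small nonzero solutions of the simultaneous system on `I`
    (hno_sol : ∀ x ∈ Icc lo hi, ∀ Q : ℝ, 1 ≤ Q →
      Q < Real.exp (β * ((q : ℝ) - 1 - (lam1 : ℝ))) →
      ¬ ∃ v : Fin (n + 3) → ℤ, v ≠ 0 ∧ |(v 0 : ℝ)| ≤ Q ∧
        ∀ i : Fin (n + 2),
          |(v 0 : ℝ) * φ x i - (v i.succ : ℝ)| < (k₁ / ((n : ℝ) + 2)) * Q ^ (-(r i))) :
    (∀ (m₁ m₂ : ℕ) (p₁ p₂ : Fin (n + 2) → ℤ),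
      (memVq n bigI φ θ d r f₀ c a b R q m₁ p₁ ∧
        ∃ j : ℕ, 1 ≤ j ∧ j ≤ mstar c (d 0) (r 0) m₁ ∧
          memV n bigI φ θ d r f₀ c a b m₁ j p₁ ∧
          (deltaSet (θ 0) c a b (d 0) (r 0) m₁ j (p₁ 0) ∩ Icc lo hi).Nonempty) →
      (memVq n bigI φ θ d r f₀ c a b R q m₂ p₂ ∧
        ∃ j : ℕ, 1 ≤ j ∧ j ≤ mstar c (d 0) (r 0) m₂ ∧
          memV n bigI φ θ d r f₀ c a b m₂ j p₂ ∧
          (deltaSet (θ 0) c a b (d 0) (r 0) m₂ j (p₂ 0) ∩ Icc lo hi).Nonempty) →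
      ∀ i : Fin (n + 2), (p₁ i : ℝ) / m₁ = (p₂ i : ℝ) / m₂)
    ∧ (∀ (m : ℕ) (p : Fin (n + 2) → ℤ),
        memVq n bigI φ θ d r f₀ c a b R q m p →
        Set.encard {j : ℕ | 1 ≤ j ∧ j ≤ mstar c (d 0) (r 0) m ∧
            memV n bigI φ θ d r f₀ c a b m j p ∧
            (deltaSet (θ 0) c a b (d 0) (r 0) m j (p 0) ∩ Icc lo hi).Nonempty}
          ≤ 2) := by
  have hR1 : 1 < R := (le_max_left _ _).trans_lt hR
  have hRab : (b - a)⁻¹ < R := (le_max_right _ _).trans_lt hR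
  have hba : 0 < b - a := sub_pos.2 hab
  have hr0 := hr_pos 0
  have hr_le : ∀ i, r i ≤ r 0 := fun i => hr_sorted 0 i (Fin.zero_le i)
  have hr_one : ∀ i, r i ≤ 1 := fun i =>
    hr_sum ▸ Finset.single_le_sum (fun j _ => (hr_pos j).le) (Finset.mem_univ i)
  have hsub : Icc a b ⊆ bigI := by
    have h3 : (1 : ℝ) ≤ (3 : ℝ) ^ (n + 3) := one_le_pow₀ (by norm_num)
    rw [hbigI]
    exact Icc_subset_Icc (by nlinarith) (by nlinarith)
  have hf₀1 : 1 ≤ f₀ := by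
    rw [hf₀, le_add_iff_nonneg_right]
    refine Real.sSup_nonneg ?_
    rintro _ ⟨x, -, i, rfl⟩
    exact abs_nonneg _
  have hφ_lip : ∀ i, ∀ x ∈ bigI, ∀ y ∈ bigI, |φ x i - φ y i| ≤ f₀ * |x - y| := by
    intro i x hx y hy
    subst hbigI
    rw [hf₀]
    exact abs_sub_le_one_add_sSup hφ_diff hφd_cont i hx hy
  have hD : ∀ i, i ≠ 0 → d i ≤ dmax2 := by
    intro i hi0
    rw [hdmax2]
    refine le_csSup ⟨∑ i, d i, ?_⟩ ⟨i, hi0, rfl⟩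
    rintro _ ⟨i, -, rfl⟩
    exact Finset.single_le_sum (fun j _ => (hd j).le) (Finset.mem_univ i)
  have hD0 : 0 ≤ dmax2 := (hd 1).le.trans (hD 1 (by simp))
  have hd0 := hd 0
  set F := f₀ + dmax2 with hF
  have hF1 : 1 ≤ F := by linarith
  have hF0 : 0 < F := by linarith
  have hlogR : 0 < Real.log R := Real.log_pos hR1
  have hβ_pos : 0 < β := by
    rw [hβ]
    positivity
  have hβr : β * (1 + r 0) = Real.log R := by
    rw [hβ]
    field_simp
  have hn3 : (0 : ℝ) < (n : ℝ) + 3 := by positivity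
  have hξn : ξ < (n : ℝ) + 3 := hξ.trans (div_lt_self hn3 (by simp))
  have hlam_nonneg : (0 : ℝ) ≤ lam1 := by
    rw [hlam1]
    have h1 : 0 ≤ Real.log (((n : ℝ) + 3) / ξ) :=
      Real.log_nonneg ((one_le_div hξ_pos).2 hξn.le)
    have h2 := hr_pos (Fin.last (n + 1))
    exact_mod_cast Int.ceil_nonneg (div_nonneg h1 (by positivity))
  have hk₁_pos : 0 < k₁ := by
    rw [hk₁]
    positivity
  have hk₁_le : k₁ ≤ Real.exp (-β * lam1) := by
    rw [hk₁]
    exact mul_le_of_le_one_left (Real.exp_pos _).le ((div_le_one hn3).2 hξn.le)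
  have hk₁_one : k₁ ≤ 1 := hk₁_le.trans (Real.exp_le_one_iff.2 (by nlinarith))
  have hc_pos : 0 < c := by
    rw [hc]
    positivity
  have hcK : 200 * ((n : ℝ) + 2) * F * c * R ^ 4 ≤ k₁ ^ (1 + r 0) := by
    have h1 : 200 * ((n : ℝ) + 2) * F * c * R ^ 4
        = k₁ ^ (1 + r 0) * (d 0 / (1 + d 0) ^ 2) := by
      rw [hc]
      field_simp
    rw [h1]
    refine mul_le_of_le_one_right (by positivity) ((div_le_one (by positivity)).2 ?_)
    nlinarith
  have hkk : k₁ ^ (1 + r 0) ≤ k₁ := Real.rpow_le_self_of_le_one hk₁_pos.le hk₁_one (by linarith)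
  set X := 2 * c * (b - a)⁻¹ * R ^ (q + 2) with hX
  have hX_pos : 0 < X := by positivity
  set Q := X ^ (1 + r 0)⁻¹ with hQ
  have hQ_pos : 0 < Q := by positivity
  have hQX : Q ^ (1 + r 0) = X := Real.rpow_inv_rpow hX_pos.le (by linarith)
  have hQ_lt : Q < Real.exp (β * ((q : ℝ) - 1 - (lam1 : ℝ))) :=
    rpow_inv_lt_exp q hc_pos hR1 (by positivity) hRab hr0 hβr hk₁_pos hk₁_le (by
      refine le_trans ?_ hcK
      have h8 : 2 ≤ 200 * ((n : ℝ) + 2) * F := by nlinarith [(n.cast_nonneg : (0 : ℝ) ≤ n)]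
      rw [mul_assoc _ c]
      gcongr)
  have hQL : Q ^ (1 + r 0) * (hi - lo) = 2 * c * R ^ 3 := by
    have hR0 : R ≠ 0 := by positivity
    rw [hQX, hX, hI_len, zpow_sub₀ hR0, zpow_one, zpow_natCast]
    field_simp
    ring
  have hL : 0 ≤ hi - lo := by
    rw [hI_len]
    positivity
  have key : ∀ (m : ℕ) (p : Fin (n + 2) → ℤ), memVq n bigI φ θ d r f₀ c a b R q m p →
      (∃ j : ℕ, 1 ≤ j ∧ j ≤ mstar c (d 0) (r 0) m ∧ memV n bigI φ θ d r f₀ c a b m j p ∧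
        (deltaSet (θ 0) c a b (d 0) (r 0) m j (p 0) ∩ Icc lo hi).Nonempty) →
      (1 : ℝ) ≤ m ∧ (m : ℝ) < Q ∧ ∀ x ∈ Icc lo hi, ∀ i,
        |(m : ℝ) * φ x i - p i - θ i x| ≤ F * (7 * (c * R ^ 3 * Q ^ (-(r i)))) := by
    rintro m p ⟨⟨hm, -⟩, hmX, hmX'⟩ ⟨j, hj1, hj, hV, hΔ⟩
    have hm0 : (0 : ℝ) < m := lt_trans (by positivity) hm
    have hm1 : (1 : ℝ) ≤ m := by exact_mod_cast (by exact_mod_cast hm0 : 0 < m)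
    have hmQ : (m : ℝ) < Q := by
      rwa [← Real.rpow_lt_rpow_iff hm0.le hQ_pos.le (by linarith : 0 < 1 + r 0), hQX]
    refine ⟨hm1, hmQ, fun x hx i => ?_⟩
    refine (abs_linear_form_le hr_le hab hlen hsub hφ_first hf₀1 hφ_lip hd hθ_lip hD0 hD hc_pos
      hI_sub hm hj1 hj hV hΔ hx i).trans ?_
    refine mul_le_mul_of_nonneg_left ?_ (by linarith)
    refine error_le_of_scale hc_pos hR1.le hm1 hmQ.le hr0 (hr_pos i) (hr_one i) (hr_le i) hL ?_ hQL
    calc Q ^ (1 + r 0) = R * (2 * c * (b - a)⁻¹ * R ^ (q + 1)) := by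
          rw [hQX, hX]
          ring
      _ ≤ _ := by gcongr
  refine ⟨?_, ?_⟩
  · rintro m₁ m₂ p₁ p₂ ⟨hv₁, hj₁⟩ ⟨hv₂, hj₂⟩
    obtain ⟨hm₁, hmQ₁, hb₁⟩ := key m₁ p₁ hv₁ hj₁
    obtain ⟨hm₂, hmQ₂, hb₂⟩ := key m₂ p₂ hv₂ hj₂
    obtain ⟨-, -, -, -, x, -, hx⟩ := hj₁
    by_cases hv : (Fin.cons ((m₁ : ℤ) - m₂) (fun i => p₁ i - p₂ i) : Fin (n + 3) → ℤ) = 0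
    · intro i
      have h0 : (m₁ : ℤ) - m₂ = 0 := by simpa using congrFun hv 0
      have h1 : p₁ i - p₂ i = 0 := by simpa using congrFun hv i.succ
      rw [sub_eq_zero] at h0 h1
      rw [h1, (by exact_mod_cast h0 : m₁ = m₂)]
    · refine absurd ⟨_, hv, ?_, fun i => ?_⟩ (hno_sol x hx Q (by linarith) hQ_lt)
      · rw [Fin.cons_zero, abs_le]
        push_cast
        constructor <;> linarith
      · rw [Fin.cons_zero, Fin.cons_succ]
        push_cast
        have e : ((m₁ : ℝ) - m₂) * φ x i - (p₁ i - p₂ i)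
            = (m₁ * φ x i - p₁ i - θ i x) - (m₂ * φ x i - p₂ i - θ i x) := by ring
        have h1 : F * (7 * (c * R ^ 3)) + F * (7 * (c * R ^ 3)) < k₁ / ((n : ℝ) + 2) := by
          rw [lt_div_iff₀ (by positivity)]
          have h2 : 0 < ((n : ℝ) + 2) * F * c * R ^ 3 := by positivity
          have h3 := hcK.trans hkk
          nlinarith
        have hQr : 0 < Q ^ (-(r i)) := by positivity
        rw [e]
        calc _ ≤ F * (7 * (c * R ^ 3 * Q ^ (-(r i)))) + F * (7 * (c * R ^ 3 * Q ^ (-(r i)))) :=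
              (abs_sub _ _).trans (add_le_add (hb₁ x hx i) (hb₂ x hx i))
          _ = (F * (7 * (c * R ^ 3)) + F * (7 * (c * R ^ 3))) * Q ^ (-(r i)) := by ring
          _ < _ := by gcongr
  · rintro m p ⟨⟨hm, -⟩, -⟩
    refine encard_le_two_of_forall_le_succ ?_
    rintro j ⟨-, -, -, x, hx, hxI⟩ j' ⟨-, -, -, x', hx', hxI'⟩
    exact index_le_succ hab hlen hc_pos hd0 hm
      (hθ_lip 0 x (hsub (hI_sub hxI)) x' (hsub (hI_sub hxI'))) hx hx'
end
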